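/- Let (N,M₀) be a safe Petri net with unfolding U and B⊆2^P reachability-closed. If C' is a finite ⊆-maximal configuration of U with Mark(C')∉B, then the choice C₁:=C' and C₂:=C' satisfies: C₁⊆C₂, Mark(C₂)∉B, Mark(C₁)=Mark(C₂), and every event enabled by C₁ has a spoiler in C₂ (vacuously, since no event is enabled by a maximal configuration). Consequently, a finite configuration C of U is free if and only if there exist finite configurations C₁,C₂ with C⊆C₁⊆C₂, Mark(C₂)∉B, Mark(C₁)=Mark(C₂), and every event enabled by C₁ has a spoiler in C₂. -/

import Mathlib

/-- A net `N = (P,T,F)`: the flow relation is split into its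
place-to-transition part `pt` and transition-to-place part `tp`. -/
structure Net (P T : Type) where
  pt : P → T → Prop
  tp : T → P → Prop

namespace Net

variable {P T : Type} (N : Net P T)

/-- Preset of a transition: `•t`. -/
def preT (t : T) : Set P := {p | N.pt p t}
/-- Postset of a transition: `t•`. -/
def postT (t : T) : Set P := {p | N.tp t p}
/-- Preset of a place: `•p`. -/
def preP (p : P) : Set T := {t | N.tp t p}
/-- Postset of a place: `p•`. -/
def postP (p : P) : Set T := {t | N.pt p t}

/-- Transition `t` is enabled at marking `M` iff `•t ⊆ M`. -/
def enabled (M : Set P) (t : T) : Prop := N.preT t ⊆ M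
/-- Firing `t` at `M` yields `(M \ •t) ∪ t•`. -/
def fire (M : Set P) (t : T) : Set P := (M \ N.preT t) ∪ N.postT t
/-- One firing step between markings. -/
def stepRel (M M' : Set P) : Prop := ∃ t : T, N.enabled M t ∧ M' = N.fire M t
/-- Reachability between markings (finite firing sequences). -/
def reach (M M' : Set P) : Prop := Relation.ReflTransGen N.stepRel M M'

/-- `(N, M₀)` is safe. -/
def safe (M₀ : Set P) : Prop :=
  ∀ M : Set P, N.reach M₀ M → ∀ t : T, N.enabled M t → M ∩ N.postT t ⊆ N.preT t

/-- `FiringSeq M l M'`: the sequence `l` of transitions can fire from `M`, ending in `M'`. -/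
inductive FiringSeq : Set P → List T → Set P → Prop
  | nil (M : Set P) : FiringSeq M [] M
  | cons {M : Set P} (t : T) {l : List T} {M' : Set P} :
      N.enabled M t → FiringSeq (N.fire M t) l M' → FiringSeq M (t :: l) M'

/-- The underlying edge relation of the flow, on nodes `P ⊕ T`. -/
def edge : (P ⊕ T) → (P ⊕ T) → Prop
  | Sum.inl p, Sum.inr t => N.pt p t
  | Sum.inr t, Sum.inl p => N.tp t p
  | _, _ => False

/-- Causality: `x < y` via a nonempty directed path. -/
def ltN (x y : P ⊕ T) : Prop := Relation.TransGen N.edge x y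
/-- `x ≤ y` iff `x < y` or `x = y`. -/
def leN (x y : P ⊕ T) : Prop := N.ltN x y ∨ x = y

/-- Direct conflict of transitions: `•u ∩ •v ≠ ∅`. -/
def dirConflict (u v : T) : Prop := (N.preT u ∩ N.preT v).Nonempty
/-- Conflict of nodes `x # y`. -/
def conflict (x y : P ⊕ T) : Prop :=
  ∃ u v : T, u ≠ v ∧ N.leN (Sum.inr u) x ∧ N.leN (Sum.inr v) y ∧ N.dirConflict u v
/-- Concurrency of nodes. -/
def concurrent (x y : P ⊕ T) : Prop :=
  ¬ N.leN x y ∧ ¬ N.leN y x ∧ ¬ N.conflict x y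
/-- A co-set: a set of pairwise concurrent places (conditions). -/
def coset (S : Set P) : Prop :=
  ∀ b ∈ S, ∀ b' ∈ S, b ≠ b' → N.concurrent (Sum.inl b) (Sum.inl b')

end Net

/-- An occurrence net `O = (B, E, F, c₀)`: conditions `B`, events `E`. -/
structure OccNet (B E : Type) extends Net B E where
  c₀ : Set B
  lt_irrefl : ∀ x : B ⊕ E, ¬ toNet.ltN x x
  pre_subsingleton : ∀ b : B, (toNet.preP b).Subsingleton
  mem_c₀_iff : ∀ b : B, b ∈ c₀ ↔ toNet.preP b = ∅
  no_self_conflict : ∀ e : E, ¬ toNet.conflict (Sum.inr e) (Sum.inr e)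
  finite_past : ∀ e : E, {x : B ⊕ E | toNet.leN x (Sum.inr e)}.Finite

namespace OccNet

variable {B E : Type} (O : OccNet B E)

/-- A configuration: a causally closed, conflict-free set of events. -/
def config (C : Set E) : Prop :=
  (∀ e ∈ C, ∀ e' : E, O.toNet.ltN (Sum.inr e') (Sum.inr e) → e' ∈ C) ∧
  (∀ e ∈ C, ∀ e' ∈ C, ¬ O.toNet.conflict (Sum.inr e) (Sum.inr e'))

/-- A run: a `⊆`-maximal configuration. -/
def run (ω : Set E) : Prop :=
  O.config ω ∧ ∀ C : Set E, O.config C → ω ⊆ C → C = ω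

/-- `cut C = (c₀ ∪ C•) \ •C`. -/
def cut (C : Set E) : Set B :=
  (O.c₀ ∪ {b | ∃ e ∈ C, O.toNet.tp e b}) \ {b | ∃ e ∈ C, O.toNet.pt b e}

/-- Event `e` is enabled by configuration `C`. -/
def enabledBy (C : Set E) (e : E) : Prop := e ∉ C ∧ O.config (C ∪ {e})

/-- `crest C`: the `<`-maximal events of `C`. -/
def crest (C : Set E) : Set E :=
  {e | e ∈ C ∧ ¬ ∃ e' ∈ C, O.toNet.ltN (Sum.inr e) (Sum.inr e')}

/-- The stump `⌊e⌋ = {e' : e' < e}` of an event. -/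
def stump (e : E) : Set E := {e' | O.toNet.ltN (Sum.inr e') (Sum.inr e)}

/-- `spoiler e e'`: `e'` is a spoiler of `e`, i.e. `•e' ∩ •e ≠ ∅`. -/
def spoiler (e e' : E) : Prop := (O.toNet.preT e' ∩ O.toNet.preT e).Nonempty

/-- An event is unchallenged iff no other event shares a precondition with it. -/
def unchallenged (e : E) : Prop :=
  ¬ ∃ e' : E, e' ≠ e ∧ (O.toNet.preT e' ∩ O.toNet.preT e).Nonempty

/-- A configuration is shaved iff its crest contains no unchallenged event. -/
def shaved (C : Set E) : Prop := ∀ e ∈ O.crest C, ¬ O.unchallenged e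

/-- Strict `C`-conflict `e #^C e'`: `e ≠ e'`, `•e ∩ •e' ≠ ∅`, and `⌊e'⌋ ⊆ C`. -/
def strictConflict (C : Set E) (e e' : E) : Prop :=
  e ≠ e' ∧ (O.toNet.preT e ∩ O.toNet.preT e').Nonempty ∧ O.stump e' ⊆ C

/-- Decisional height `δ(C)`: the number of events of `C` in strict `C`-conflict
with some event. -/
noncomputable def dHeight (C : Set E) : ℕ :=
  {e | e ∈ C ∧ ∃ e' : E, O.strictConflict C e e'}.ncard

end OccNet

/-- The unfolding `U = U(N, M₀)` of a Petri net `(N, M₀)`: an occurrence net with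
conditions `B` and events `E`, together with the folding map (`fB` on conditions,
`fE` on events), satisfying the defining properties of the inductive construction:
the initial cut corresponds bijectively to `M₀`; the preset of an event `e` is a
co-set folded bijectively onto `•f(e)` and its postset is folded bijectively onto
`f(e)•`; events are uniquely determined by (preset, label) and exist for every
co-set folding onto some `•t`; conditions are uniquely determined by
(producing event, label). -/
structure Unfolding (P T : Type) (N : Net P T) (M₀ : Set P) (B E : Type) where
  occ : OccNet B E
  fB : B → P
  fE : E → T
  init_bij : Set.BijOn fB occ.c₀ M₀
  pre_coset : ∀ e : E, occ.toNet.coset (occ.toNet.preT e)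
  pre_bij : ∀ e : E, Set.BijOn fB (occ.toNet.preT e) (N.preT (fE e))
  post_bij : ∀ e : E, Set.BijOn fB (occ.toNet.postT e) (N.postT (fE e))
  event_unique : ∀ e e' : E,
    occ.toNet.preT e = occ.toNet.preT e' → fE e = fE e' → e = e'
  event_exists : ∀ (S : Set B) (t : T), occ.toNet.coset S → Set.BijOn fB S (N.preT t) →
    ∃ e : E, occ.toNet.preT e = S ∧ fE e = t
  cond_unique : ∀ b b' : B,
    occ.toNet.preP b = occ.toNet.preP b' → fB b = fB b' → b = b'

/-- `Bad` is reachability-closed: `M ∈ Bad` and `M → M'` imply `M' ∈ Bad`. -/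
def ReachClosed {P T : Type} (N : Net P T) (Bad : Set (Set P)) : Prop :=
  ∀ M ∈ Bad, ∀ M' : Set P, N.reach M M' → M' ∈ Bad

namespace Unfolding

variable {P T B E : Type} {N : Net P T} {M₀ : Set P} (U : Unfolding P T N M₀ B E)

/-- `Mark C = f(cut C)`. -/
def Mark (C : Set E) : Set P := U.fB '' U.occ.cut C

/-- A finite configuration is doomed iff every run extending it contains a finite
configuration (extending it) whose marking is bad. -/
def doomed (Bad : Set (Set P)) (C : Set E) : Prop :=
  ∀ ω : Set E, U.occ.run ω → C ⊆ ω →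
    ∃ C' : Set E, C'.Finite ∧ U.occ.config C' ∧ C ⊆ C' ∧ C' ⊆ ω ∧ U.Mark C' ∈ Bad

/-- A configuration is free iff it is not doomed. -/
def free (Bad : Set (Set P)) (C : Set E) : Prop := ¬ U.doomed Bad C

/-- A finite configuration is minimally doomed iff it is doomed and no proper
sub-configuration of it is doomed. -/
def minDoomed (Bad : Set (Set P)) (C : Set E) : Prop :=
  C.Finite ∧ U.occ.config C ∧ U.doomed Bad C ∧
  ∀ C' : Set E, C' ⊂ C → U.occ.config C' → ¬ U.doomed Bad C'

/-- A (finite) prefix of the unfolding: a finite, causally closed set of events. -/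
def isPrefix (E' : Set E) : Prop :=
  E'.Finite ∧ ∀ e ∈ E', ∀ e' : E, U.occ.toNet.ltN (Sum.inr e') (Sum.inr e) → e' ∈ E'

/-- A complete prefix `Π₀` of the unfolding. -/
def isCompletePrefix (E' : Set E) : Prop :=
  U.isPrefix E' ∧
  ∀ M : Set P, N.reach M₀ M →
    ∃ C : Set E, U.occ.config C ∧ C ⊆ E' ∧ U.Mark C = M ∧
      ∀ t : T, N.enabled M t → ∃ e ∈ E', U.fE e = t ∧ U.occ.enabledBy C e

/-- `isPi1 E₀ E₁`: `E₀` is a complete prefix `Π₀` and `E₁` is the prefix `Π₁`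
obtained by appending, after every `⊆`-maximal configuration `Cm` of `Π₀`, a
complete prefix of the unfolding of `(N, Mark Cm)`. -/
def isPi1 (E₀ E₁ : Set E) : Prop :=
  U.isCompletePrefix E₀ ∧ U.isPrefix E₁ ∧ E₀ ⊆ E₁ ∧
  ∀ Cm : Set E, U.occ.config Cm → Cm ⊆ E₀ →
    (∀ C' : Set E, U.occ.config C' → C' ⊆ E₀ → Cm ⊆ C' → C' = Cm) →
    ∀ M : Set P, N.reach (U.Mark Cm) M →
      ∃ C : Set E, U.occ.config C ∧ Cm ⊆ C ∧ C ⊆ E₁ ∧ U.Mark C = M ∧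
        ∀ t : T, N.enabled M t → ∃ e ∈ E₁, U.fE e = t ∧ U.occ.enabledBy C e

end Unfolding

namespace Net

variable {P T : Type} {N : Net P T}

theorem exists_pre_of_ltN {x : P ⊕ T} {t : T} (h : N.ltN x (Sum.inr t)) :
    ∃ p, N.pt p t ∧ N.leN x (Sum.inl p) := by
  obtain ⟨y, hxy, hy⟩ := Relation.TransGen.tail'_iff.1 h
  rcases y with p | t'
  · refine ⟨p, hy, ?_⟩
    rcases Relation.reflTransGen_iff_eq_or_transGen.1 hxy with h | h
    · exact Or.inr h.symm
    · exact Or.inl h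
  · exact hy.elim

theorem exists_producer_of_ltN {x : P ⊕ T} {p : P} (h : N.ltN x (Sum.inl p)) :
    ∃ t, N.tp t p ∧ N.leN x (Sum.inr t) := by
  obtain ⟨y, hxy, hy⟩ := Relation.TransGen.tail'_iff.1 h
  rcases y with p' | t
  · exact hy.elim
  · refine ⟨t, hy, ?_⟩
    rcases Relation.reflTransGen_iff_eq_or_transGen.1 hxy with h | h
    · exact Or.inr h.symm
    · exact Or.inl h

theorem exists_consumer_of_ltN {p : P} {y : P ⊕ T} (h : N.ltN (Sum.inl p) y) :
    ∃ t, N.pt p t ∧ N.leN (Sum.inr t) y := by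
  obtain ⟨z, hz, hzy⟩ := Relation.TransGen.head'_iff.1 h
  rcases z with p' | t
  · exact hz.elim
  · refine ⟨t, hz, ?_⟩
    rcases Relation.reflTransGen_iff_eq_or_transGen.1 hzy with h | h
    · exact Or.inr h.symm
    · exact Or.inl h

theorem exists_producer_of_leN {t : T} {p : P} (h : N.leN (Sum.inr t) (Sum.inl p)) :
    ∃ t', N.tp t' p ∧ N.leN (Sum.inr t) (Sum.inr t') := by
  rcases h with h | h
  · exact exists_producer_of_ltN h
  · cases h

theorem ltN_of_tp_of_pt {t t' : T} {p : P} (h : N.tp t p) (h' : N.pt p t') :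
    N.ltN (Sum.inr t) (Sum.inr t') :=
  Relation.TransGen.tail (b := Sum.inl p) (Relation.TransGen.single h) h'

end Net

namespace OccNet

variable {B E : Type} {O : OccNet B E}

theorem config.mem_of_leN {C : Set E} (hC : O.config C) {e e' : E} (he : e ∈ C)
    (h : O.toNet.leN (Sum.inr e') (Sum.inr e)) : e' ∈ C := by
  rcases h with h | h
  · exact hC.1 e he e' h
  · cases h; exact he

theorem config.eq_of_pt {C : Set E} (hC : O.config C) {e e' : E} (he : e ∈ C) (he' : e' ∈ C)
    {b : B} (h : O.toNet.pt b e) (h' : O.toNet.pt b e') : e = e' := by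
  by_contra hne
  exact hC.2 e he e' he' ⟨e, e', hne, Or.inr rfl, Or.inr rfl, b, h, h'⟩

theorem config.mono {C D : Set E} (hD : O.config D) (hCD : C ⊆ D)
    (hclosed : ∀ e ∈ C, ∀ e' : E, O.toNet.ltN (Sum.inr e') (Sum.inr e) → e' ∈ C) :
    O.config C :=
  ⟨hclosed, fun e he e' he' => hD.2 e (hCD he) e' (hCD he')⟩

theorem config_iff_eq_of_pt {C : Set E} : O.config C ↔
    (∀ e ∈ C, ∀ e' : E, O.toNet.ltN (Sum.inr e') (Sum.inr e) → e' ∈ C) ∧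
    (∀ e ∈ C, ∀ e' ∈ C, ∀ b, O.toNet.pt b e → O.toNet.pt b e' → e = e') := by
  constructor
  · exact fun h => ⟨h.1, fun e he e' he' b hb hb' => h.eq_of_pt he he' hb hb'⟩
  · rintro ⟨h1, h2⟩
    have mem : ∀ e ∈ C, ∀ e', O.toNet.leN (Sum.inr e') (Sum.inr e) → e' ∈ C := by
      rintro e he e' (h | h)
      · exact h1 e he e' h
      · cases h; exact he
    refine ⟨h1, ?_⟩
    rintro e he e' he' ⟨u, v, huv, hu, hv, b, hb, hb'⟩
    exact huv (h2 u (mem e he u hu) v (mem e' he' v hv) b hb hb')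

theorem config_empty : O.config ∅ :=
  ⟨fun _ h => h.elim, fun _ h => h.elim⟩

/-- A configuration remains one after adding an event whose past it contains and which it
does not spoil. -/
theorem config.union_singleton {C : Set E} (hC : O.config C) {e : E} (hpast : O.stump e ⊆ C)
    (hsp : ∀ e' ∈ C, ¬ O.spoiler e e') : O.config (C ∪ {e}) := by
  rw [config_iff_eq_of_pt]
  constructor
  · rintro x (hx | rfl) y hy
    · exact Or.inl (hC.1 x hx y hy)
    · exact Or.inl (hpast hy)
  · rintro x (hx | rfl) y (hy | rfl) b hbx hby
    · exact hC.eq_of_pt hx hy hbx hby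
    · exact (hsp x hx ⟨b, hbx, hby⟩).elim
    · exact (hsp y hy ⟨b, hby, hbx⟩).elim
    · rfl

theorem enabledBy.stump_subset {C : Set E} {e : E} (h : O.enabledBy C e) : O.stump e ⊆ C := by
  intro e' he'
  rcases h.2.1 e (Or.inr rfl) e' he' with h' | rfl
  · exact h'
  · exact (O.lt_irrefl _ he').elim

theorem mem_c₀_or_exists_producer (b : B) : b ∈ O.c₀ ∨ ∃ e, O.toNet.tp e b := by
  by_cases h : b ∈ O.c₀
  · exact Or.inl h
  · rw [O.mem_c₀_iff, ← ne_eq, ← Set.nonempty_iff_ne_empty] at h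
    exact Or.inr h

theorem not_mem_c₀_of_tp {e : E} {b : B} (h : O.toNet.tp e b) : b ∉ O.c₀ := by
  rw [O.mem_c₀_iff, ← ne_eq, ← Set.nonempty_iff_ne_empty]
  exact ⟨e, h⟩

theorem enabledBy.pre_subset_cut {C : Set E} {e : E} (h : O.enabledBy C e) :
    O.toNet.preT e ⊆ O.cut C := by
  intro b hb
  refine ⟨?_, ?_⟩
  · rcases O.mem_c₀_or_exists_producer b with h' | ⟨g, hg⟩
    · exact Or.inl h'
    · exact Or.inr ⟨g, h.stump_subset (Net.ltN_of_tp_of_pt hg hb), hg⟩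
  · rintro ⟨g, hg, hbg⟩
    have := h.2.eq_of_pt (Or.inl hg) (Or.inr rfl) hbg hb
    exact h.1 (this ▸ hg)

theorem producer_mem_of_mem_cut {C : Set E} {b : B} (hb : b ∈ O.cut C) {e : E}
    (he : O.toNet.tp e b) : e ∈ C := by
  rcases hb.1 with h | ⟨g, hg, hgb⟩
  · exact (not_mem_c₀_of_tp he h).elim
  · rwa [O.pre_subsingleton b he hgb]

theorem config.coset_cut {C : Set E} (hC : O.config C) : O.toNet.coset (O.cut C) := by
  have key : ∀ b ∈ O.cut C, ∀ b' ∈ O.cut C, b ≠ b' →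
      ¬ O.toNet.leN (Sum.inl b) (Sum.inl b') := by
    rintro b hb b' hb' hne (h | h)
    · obtain ⟨g, hg, hbg⟩ := Net.exists_producer_of_ltN h
      have hgC := producer_mem_of_mem_cut hb' hg
      rcases hbg with hbg | hbg
      · obtain ⟨k, hk, hkg⟩ := Net.exists_consumer_of_ltN hbg
        exact hb.2 ⟨k, hC.mem_of_leN hgC hkg, hk⟩
      · cases hbg
    · exact hne (Sum.inl_injective h)
  intro b hb b' hb' hne
  refine ⟨key b hb b' hb' hne, key b' hb' b hb hne.symm, ?_⟩
  rintro ⟨u, v, huv, hu, hv, c, hc, hc'⟩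
  obtain ⟨g, hg, hug⟩ := Net.exists_producer_of_leN hu
  obtain ⟨g', hg', hvg⟩ := Net.exists_producer_of_leN hv
  exact huv (hC.eq_of_pt (hC.mem_of_leN (producer_mem_of_mem_cut hb hg) hug)
    (hC.mem_of_leN (producer_mem_of_mem_cut hb' hg') hvg) hc hc')

theorem config.enabledBy_of_pre_subset_cut {C : Set E} (hC : O.config C) {e : E}
    (hne : (O.toNet.preT e).Nonempty) (h : O.toNet.preT e ⊆ O.cut C) : O.enabledBy C e := by
  refine ⟨?_, hC.union_singleton ?_ ?_⟩
  · obtain ⟨b, hb⟩ := hne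
    exact fun he => (h hb).2 ⟨e, he, hb⟩
  · intro e' he'
    obtain ⟨b, hb, hle⟩ := Net.exists_pre_of_ltN he'
    obtain ⟨g, hg, hle'⟩ := Net.exists_producer_of_leN hle
    exact hC.mem_of_leN (producer_mem_of_mem_cut (h hb) hg) hle'
  · rintro e' he' ⟨b, hb, hb'⟩
    exact (h hb').2 ⟨e', he', hb⟩

theorem stump_finite (e : E) : (O.stump e).Finite :=
  ((O.finite_past e).preimage Sum.inr_injective.injOn).subset fun _ h => Or.inl h

theorem stump_eq_empty {e : E} (h : O.toNet.preT e = ∅) : O.stump e = ∅ := by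
  refine Set.eq_empty_of_forall_notMem fun e' he' => ?_
  obtain ⟨b, hb, -⟩ := Net.exists_pre_of_ltN he'
  exact Set.eq_empty_iff_forall_notMem.1 h b hb

theorem run.exists_spoiler {ω : Set E} (hω : O.run ω) {e : E} (he : e ∉ ω)
    (hpast : O.stump e ⊆ ω) : ∃ e' ∈ ω, O.spoiler e e' := by
  by_contra! hcon
  have := hω.2 _ (hω.1.union_singleton hpast hcon) Set.subset_union_left
  exact he (this ▸ Or.inr rfl)

theorem config.exists_finite_superset {ω S : Set E} (hω : O.config ω) (hS : S.Finite)
    (hSω : S ⊆ ω) : ∃ D : Set E, D.Finite ∧ O.config D ∧ S ⊆ D ∧ D ⊆ ω := by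
  refine ⟨S ∪ ⋃ e ∈ S, O.stump e, hS.union (hS.biUnion fun e _ => stump_finite e), ?_,
    Set.subset_union_left, ?_⟩
  · refine hω.mono ?_ ?_
    · rintro x (hx | hx)
      · exact hSω hx
      · simp only [Set.mem_iUnion] at hx
        obtain ⟨e, he, hx⟩ := hx
        exact hω.1 e (hSω he) x hx
    · rintro x (hx | hx) y hy
      · exact Or.inr (Set.mem_biUnion hx hy)
      · simp only [Set.mem_iUnion] at hx
        obtain ⟨e, he, hx⟩ := hx
        exact Or.inr (Set.mem_biUnion he (Relation.TransGen.trans hy hx))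
  · rintro x (hx | hx)
    · exact hSω hx
    · simp only [Set.mem_iUnion] at hx
      obtain ⟨e, he, hx⟩ := hx
      exact hω.1 e (hSω he) x hx

/-- One configuration extends another by a single event. -/
def extend (O : OccNet B E) (C D : Set E) : Prop := ∃ e, O.enabledBy C e ∧ D = C ∪ {e}

theorem subset_of_reflTransGen_extend {C D : Set E}
    (h : Relation.ReflTransGen O.extend C D) : C ⊆ D := by
  induction h with
  | refl => exact subset_rfl
  | tail _ hstep ih =>
    obtain ⟨e, -, rfl⟩ := hstep
    exact ih.trans Set.subset_union_left

theorem config.extend_of_subset {C D : Set E} (hC : O.config C) (hD : O.config D)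
    (hDfin : D.Finite) (hCD : C ⊆ D) : Relation.ReflTransGen O.extend C D := by
  induction hn : (D \ C).ncard using Nat.strong_induction_on generalizing C with
  | _ n ih =>
    rcases Set.eq_empty_or_nonempty (D \ C) with hemp | hne
    · rw [hCD.antisymm (Set.sdiff_eq_empty.1 hemp)]
    · let r : E → E → Prop := fun x y => O.toNet.ltN (Sum.inr x) (Sum.inr y)
      have : IsStrictOrder E r :=
        { irrefl := fun x => O.lt_irrefl _
          trans := fun x y z => Relation.TransGen.trans }
      have hfin : (D \ C).Finite := hDfin.subset Set.sdiff_subset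
      obtain ⟨e, he, hmin⟩ : ∃ e ∈ D \ C, ∀ x ∈ D \ C, ¬ r x e := by
        have hwf : (D \ C).WellFoundedOn r := hfin.wellFoundedOn
        obtain ⟨⟨e, he⟩, -, hmin⟩ := WellFounded.has_min hwf Set.univ
          ⟨⟨hne.some, hne.some_mem⟩, trivial⟩
        exact ⟨e, he, fun x hx hxe => hmin ⟨x, hx⟩ trivial hxe⟩
      have hpast : O.stump e ⊆ C := by
        intro x hx
        by_contra hxC
        exact hmin x ⟨hD.1 e he.1 x hx, hxC⟩ hx
      have hsub : C ∪ {e} ⊆ D := Set.union_subset hCD (Set.singleton_subset_iff.2 he.1)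
      have hconf : O.config (C ∪ {e}) := by
        refine hD.mono hsub ?_
        rintro x (hx | rfl) y hy
        · exact Or.inl (hC.1 x hx y hy)
        · exact Or.inl (hpast hy)
      refine Relation.ReflTransGen.head ⟨e, ⟨he.2, hconf⟩, rfl⟩ (ih _ ?_ hconf hsub rfl)
      rw [← hn]
      refine Set.ncard_lt_ncard ?_ hfin
      refine ⟨Set.sdiff_subset_sdiff_right Set.subset_union_left, fun h => ?_⟩
      exact (h he).2 (Or.inr rfl)

theorem enabledBy.cut_union {C : Set E} {e : E} (h : O.enabledBy C e) (hC : O.config C) :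
    O.cut (C ∪ {e}) = (O.cut C \ O.toNet.preT e) ∪ O.toNet.postT e := by
  ext b
  constructor
  · rintro ⟨hb, hb'⟩
    have h1 : ¬ ∃ x ∈ C, O.toNet.pt b x := fun ⟨x, hx, hbx⟩ => hb' ⟨x, Or.inl hx, hbx⟩
    have h2 : ¬ O.toNet.pt b e := fun hbe => hb' ⟨e, Or.inr rfl, hbe⟩
    rcases hb with hb | ⟨x, hx | rfl, hxb⟩
    · exact Or.inl ⟨⟨Or.inl hb, h1⟩, h2⟩
    · exact Or.inl ⟨⟨Or.inr ⟨x, hx, hxb⟩, h1⟩, h2⟩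
    · exact Or.inr hxb
  · rintro (⟨⟨hb, hb'⟩, hbe⟩ | hb)
    · refine ⟨?_, ?_⟩
      · rcases hb with hb | ⟨x, hx, hxb⟩
        · exact Or.inl hb
        · exact Or.inr ⟨x, Or.inl hx, hxb⟩
      · rintro ⟨x, hx | rfl, hxb⟩
        · exact hb' ⟨x, hx, hxb⟩
        · exact hbe hxb
    · refine ⟨Or.inr ⟨e, Or.inr rfl, hb⟩, ?_⟩
      rintro ⟨x, hx, hxb⟩
      have hlt := Net.ltN_of_tp_of_pt hb hxb
      rcases hx with hx | rfl
      · exact h.1 (hC.1 x hx e hlt)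
      · exact O.lt_irrefl _ hlt

end OccNet

namespace Unfolding

variable {P T B E : Type} {N : Net P T} {M₀ : Set P} {U : Unfolding P T N M₀ B E}

theorem preT_eq_empty_iff {e : E} : U.occ.toNet.preT e = ∅ ↔ N.preT (U.fE e) = ∅ := by
  rw [← (U.pre_bij e).image_eq, Set.image_eq_empty]

theorem finite_setOf_preT_subset [Finite T] {S : Set B} (hS : S.Finite) :
    {e | U.occ.toNet.preT e ⊆ S}.Finite := by
  refine Set.Finite.of_injOn (t := S.powerset ×ˢ (Set.univ : Set T))
    (f := fun e => (U.occ.toNet.preT e, U.fE e)) (fun e he => ⟨he, trivial⟩) ?_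
    (hS.finite_subsets.prod Set.finite_univ)
  intro e _ e' _ h
  exact U.event_unique e e' (congrArg Prod.fst h) (congrArg Prod.snd h)

theorem finite_cut [Finite P] {C : Set E} (hC : C.Finite) : (U.occ.cut C).Finite := by
  have h0 : U.occ.c₀.Finite :=
    Set.Finite.of_injOn U.init_bij.mapsTo U.init_bij.injOn (Set.toFinite _)
  have h1 : ∀ e, (U.occ.toNet.postT e).Finite := fun e =>
    Set.Finite.of_injOn (U.post_bij e).mapsTo (U.post_bij e).injOn (Set.toFinite _)
  refine ((h0.union (hC.biUnion fun e _ => h1 e))).subset ?_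
  rintro b ⟨hb | ⟨e, he, hb⟩, -⟩
  · exact Or.inl hb
  · exact Or.inr (Set.mem_biUnion he hb)

theorem finite_enabledBy [Finite P] [Finite T] {C : Set E} (hC : C.Finite) :
    {e | U.occ.enabledBy C e}.Finite :=
  (finite_setOf_preT_subset (U := U) (finite_cut hC)).subset fun _ h => h.pre_subset_cut

theorem enabled_of_enabledBy {C : Set E} {e : E} (h : U.occ.enabledBy C e) :
    N.enabled (U.Mark C) (U.fE e) := by
  unfold Net.enabled
  rw [← (U.pre_bij e).image_eq]
  exact Set.image_mono h.pre_subset_cut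

theorem Mark_union {C : Set E} (hC : U.occ.config C) (hinj : Set.InjOn U.fB (U.occ.cut C))
    {e : E} (h : U.occ.enabledBy C e) :
    U.Mark (C ∪ {e}) = N.fire (U.Mark C) (U.fE e) := by
  unfold Mark Net.fire
  rw [h.cut_union hC, Set.image_union, hinj.image_sdiff_subset h.pre_subset_cut,
    (U.pre_bij e).image_eq, (U.post_bij e).image_eq]

theorem injOn_cut_union (hsafe : N.safe M₀) {C : Set E} (hC : U.occ.config C)
    (hreach : N.reach M₀ (U.Mark C)) (hinj : Set.InjOn U.fB (U.occ.cut C))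
    {e : E} (h : U.occ.enabledBy C e) : Set.InjOn U.fB (U.occ.cut (C ∪ {e})) := by
  rw [h.cut_union hC]
  have hdisj : ∀ b ∈ U.occ.cut C \ U.occ.toNet.preT e, ∀ b' ∈ U.occ.toNet.postT e,
      U.fB b ≠ U.fB b' := by
    rintro b ⟨hb, hbe⟩ b' hb' heq
    have hmem := hsafe _ hreach (U.fE e) (enabled_of_enabledBy h)
      ⟨Set.mem_image_of_mem _ hb, heq ▸ (U.post_bij e).mapsTo hb'⟩
    rw [← (U.pre_bij e).image_eq] at hmem
    obtain ⟨c, hc, hcb⟩ := hmem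
    exact hbe (hinj (h.pre_subset_cut hc) hb hcb ▸ hc)
  rintro b (hb | hb) b' (hb' | hb') heq
  · exact hinj hb.1 hb'.1 heq
  · exact (hdisj b hb b' hb' heq).elim
  · exact (hdisj b' hb' b hb heq.symm).elim
  · exact (U.post_bij e).injOn hb hb' heq

theorem reach_Mark_and_injOn_cut (hsafe : N.safe M₀) {C : Set E} (hfin : C.Finite)
    (hC : U.occ.config C) : N.reach M₀ (U.Mark C) ∧ Set.InjOn U.fB (U.occ.cut C) := by
  have hchain := (U.occ.config_empty).extend_of_subset hC hfin (Set.empty_subset C)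
  have key : U.occ.config C ∧ N.reach M₀ (U.Mark C) ∧ Set.InjOn U.fB (U.occ.cut C) := by
    clear hC hfin
    induction hchain with
    | refl =>
      have hcut : U.occ.cut ∅ = U.occ.c₀ := by simp [OccNet.cut]
      refine ⟨U.occ.config_empty, ?_, ?_⟩
      · unfold Mark
        rw [hcut, U.init_bij.image_eq]
        exact Relation.ReflTransGen.refl
      · rw [hcut]
        exact U.init_bij.injOn
    | tail _ hstep ih =>
      obtain ⟨hconf, hreach, hinj⟩ := ih
      obtain ⟨e, he, rfl⟩ := hstep
      exact ⟨he.2, hreach.tail ⟨U.fE e, enabled_of_enabledBy he, Mark_union hconf hinj he⟩,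
        injOn_cut_union hsafe hconf hreach hinj he⟩
  exact key.2

theorem injOn_cut (hsafe : N.safe M₀) {C : Set E} (hfin : C.Finite)
    (hC : U.occ.config C) : Set.InjOn U.fB (U.occ.cut C) :=
  (reach_Mark_and_injOn_cut hsafe hfin hC).2

theorem reach_Mark_of_subset (hsafe : N.safe M₀) {C D : Set E} (hC : U.occ.config C)
    (hD : U.occ.config D) (hDfin : D.Finite) (hCD : C ⊆ D) :
    N.reach (U.Mark C) (U.Mark D) := by
  have hchain := hC.extend_of_subset hD hDfin hCD
  have key : U.occ.config D ∧ D.Finite ∧ N.reach (U.Mark C) (U.Mark D) := by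
    have hCfin := hDfin.subset hCD
    clear hD hDfin hCD
    induction hchain with
    | refl => exact ⟨hC, hCfin, Relation.ReflTransGen.refl⟩
    | tail _ hstep ih =>
      obtain ⟨hconf, hfin, hreach⟩ := ih
      obtain ⟨e, he, rfl⟩ := hstep
      exact ⟨he.2, hfin.union (Set.finite_singleton e),
        hreach.tail ⟨U.fE e, enabled_of_enabledBy he,
          Mark_union hconf (injOn_cut hsafe hfin hconf) he⟩⟩
  exact key.2.2

/-- Every transition with nonempty preset enabled at `Mark C` is the label of an event
enabled by `C`. -/
theorem exists_enabledBy {C : Set E} (hC : U.occ.config C)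
    (hinj : Set.InjOn U.fB (U.occ.cut C)) {t : T} (ht : N.enabled (U.Mark C) t)
    (hne : (N.preT t).Nonempty) : ∃ e, U.occ.enabledBy C e ∧ U.fE e = t := by
  obtain ⟨S, hS, hbij⟩ : ∃ S ⊆ U.occ.cut C, Set.BijOn U.fB S (N.preT t) := by
    refine ⟨U.occ.cut C ∩ U.fB ⁻¹' N.preT t, Set.inter_subset_left, fun b hb => hb.2,
      hinj.mono Set.inter_subset_left, ?_⟩
    intro p hp
    obtain ⟨b, hb, rfl⟩ := ht hp
    exact ⟨b, ⟨hb, hp⟩, rfl⟩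
  obtain ⟨e, rfl, rfl⟩ := U.event_exists S t
    (fun b hb b' hb' => hC.coset_cut b (hS hb) b' (hS hb')) hbij
  refine ⟨e, hC.enabledBy_of_pre_subset_cut ?_ hS, rfl⟩
  rw [Set.nonempty_iff_ne_empty, ne_eq, preT_eq_empty_iff]
  exact hne.ne_empty

/-- Replaying the events of `C₂ \ C₁` after a configuration with the same marking as `C₁`. -/
theorem exists_replay (hsafe : N.safe M₀) {C₁ C₂ : Set E} (hfin₂ : C₂.Finite)
    (hC₁ : U.occ.config C₁) (hC₂ : U.occ.config C₂) (hsub : C₁ ⊆ C₂)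
    (hiso : ∀ e, U.occ.toNet.preT e = ∅ → e ∈ C₁)
    {D : Set E} (hDfin : D.Finite) (hD : U.occ.config D) (hmark : U.Mark C₁ = U.Mark D) :
    ∃ D' : Set E, D'.Finite ∧ U.occ.config D' ∧ D ⊆ D' ∧ U.Mark C₂ = U.Mark D' ∧
      ∀ s ∈ C₂, s ∉ C₁ → ∃ A s', A.Finite ∧ U.occ.config A ∧ D ⊆ A ∧ U.occ.enabledBy A s' ∧
        A ∪ {s'} ⊆ D' ∧ U.fE s' = U.fE s := by
  have hchain := hC₁.extend_of_subset hC₂ hfin₂ hsub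
  have key : (U.occ.config C₂ ∧ C₂.Finite ∧ C₁ ⊆ C₂) ∧
    ∃ D' : Set E, D'.Finite ∧ U.occ.config D' ∧ D ⊆ D' ∧ U.Mark C₂ = U.Mark D' ∧
      ∀ s ∈ C₂, s ∉ C₁ → ∃ A s', A.Finite ∧ U.occ.config A ∧ D ⊆ A ∧ U.occ.enabledBy A s' ∧
        A ∪ {s'} ⊆ D' ∧ U.fE s' = U.fE s := by
    have hfin₁ := hfin₂.subset hsub
    clear hfin₂ hC₂ hsub
    induction hchain with
    | refl =>
      exact ⟨⟨hC₁, hfin₁, subset_rfl⟩, D, hDfin, hD, subset_rfl, hmark,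
        fun s hs hs' => (hs' hs).elim⟩
    | tail _ hstep ih =>
      obtain ⟨⟨hconf, hfin, hsub⟩, D', hD'fin, hD', hDD', hm, hs⟩ := ih
      obtain ⟨e, he, rfl⟩ := hstep
      refine ⟨⟨he.2, hfin.union (Set.finite_singleton e),
        hsub.trans Set.subset_union_left⟩, ?_⟩
      have hinj' := injOn_cut hsafe hD'fin hD'
      obtain ⟨e', he', hlab⟩ := exists_enabledBy hD' hinj' (hm ▸ enabled_of_enabledBy he) (by
        rw [Set.nonempty_iff_ne_empty, ne_eq, ← preT_eq_empty_iff]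
        exact fun hemp => he.1 (hsub (hiso e hemp)))
      refine ⟨D' ∪ {e'}, hD'fin.union (Set.finite_singleton e'), he'.2,
        hDD'.trans Set.subset_union_left, ?_, ?_⟩
      · rw [Mark_union hconf (injOn_cut hsafe hfin hconf) he, Mark_union hD' hinj' he', hm, hlab]
      · rintro s (hs₂ | rfl) hs₁
        · obtain ⟨A, s', h1, h2, h3, h4, h5, h6⟩ := hs s hs₂ hs₁
          exact ⟨A, s', h1, h2, h3, h4, h5.trans Set.subset_union_left, h6⟩
        · exact ⟨D', e', hD'fin, hD', hDD', he', subset_rfl, hlab⟩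
  exact key.2

theorem mem_of_preT_eq_empty {C₁ C₂ : Set E} (hC₁ : U.occ.config C₁)
    (hspoil : ∀ e : E, U.occ.enabledBy C₁ e → ∃ e' ∈ C₂, U.occ.spoiler e e')
    {e : E} (he : U.occ.toNet.preT e = ∅) : e ∈ C₁ := by
  by_contra hmem
  have hno : ∀ e', ¬ U.occ.spoiler e e' := by
    rintro e' ⟨b, -, hb⟩
    exact Set.eq_empty_iff_forall_notMem.1 he b hb
  obtain ⟨e', -, h⟩ := hspoil e ⟨hmem, hC₁.union_singleton
    (by rw [OccNet.stump_eq_empty he]; exact Set.empty_subset _) fun e' _ => hno e'⟩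
  exact hno e' h

theorem exists_subset_of_finite_subset_iUnion {α : Type*} {D : ℕ → Set α} (hD : Monotone D)
    {S : Set α} (hS : S.Finite) (hsub : S ⊆ ⋃ n, D n) : ∃ n, S ⊆ D n := by
  induction S, hS using Set.Finite.induction_on with
  | empty => exact ⟨0, Set.empty_subset _⟩
  | @insert a S _ _ ih =>
    obtain ⟨n, hn⟩ := ih ((Set.subset_insert a S).trans hsub)
    obtain ⟨m, hm⟩ := Set.mem_iUnion.1 (hsub (Set.mem_insert a S))
    exact ⟨max n m, Set.insert_subset (hD (le_max_right n m) hm)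
      (hn.trans (hD (le_max_left n m)))⟩

/-- The loop from `C₁` to `C₂` can be iterated into a run that visits `Mark C₁` infinitely
often. -/
theorem exists_run_of_loop (hsafe : N.safe M₀) {C₁ C₂ : Set E} (hfin₂ : C₂.Finite)
    (hC₁ : U.occ.config C₁) (hC₂ : U.occ.config C₂) (hsub : C₁ ⊆ C₂)
    (hmark : U.Mark C₁ = U.Mark C₂)
    (hspoil : ∀ e : E, U.occ.enabledBy C₁ e → ∃ e' ∈ C₂, U.occ.spoiler e e') :
    ∃ ω, U.occ.run ω ∧ C₁ ⊆ ω ∧ ∀ S ⊆ ω, S.Finite →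
      ∃ D, D.Finite ∧ U.occ.config D ∧ S ⊆ D ∧ U.Mark D = U.Mark C₁ := by
  have hfin₁ := hfin₂.subset hsub
  have hiso : ∀ e, U.occ.toNet.preT e = ∅ → e ∈ C₁ :=
    fun e he => mem_of_preT_eq_empty hC₁ hspoil he
  let X := {D : Set E // D.Finite ∧ U.occ.config D ∧ U.Mark C₁ = U.Mark D}
  have hnext : ∀ D : X, ∃ D' : X, D.1 ⊆ D'.1 ∧ ∀ s ∈ C₂, s ∉ C₁ →
      ∃ A s', A.Finite ∧ U.occ.config A ∧ D.1 ⊆ A ∧ U.occ.enabledBy A s' ∧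
        A ∪ {s'} ⊆ D'.1 ∧ U.fE s' = U.fE s := by
    rintro ⟨D, hDfin, hD, hm⟩
    obtain ⟨D', h1, h2, h3, h4, h5⟩ :=
      exists_replay hsafe hfin₂ hC₁ hC₂ hsub hiso hDfin hD hm
    exact ⟨⟨D', h1, h2, hmark.trans h4⟩, h3, h5⟩
  choose next hsubnext hreplay using hnext
  let seq : ℕ → X := fun n => Nat.rec ⟨C₁, hfin₁, hC₁, rfl⟩ (fun _ D => next D) n
  have hmono : Monotone fun n => (seq n).1 := monotone_nat_of_le_succ fun n => hsubnext (seq n)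
  let ω : Set E := ⋃ n, (seq n).1
  have hmem : ∀ n, (seq n).1 ⊆ ω := fun n => Set.subset_iUnion (fun n => (seq n).1) n
  have hfinsub : ∀ S ⊆ ω, S.Finite → ∃ n, S ⊆ (seq n).1 := fun S hS hSfin =>
    exists_subset_of_finite_subset_iUnion hmono hSfin hS
  have hω : U.occ.config ω := by
    constructor
    · intro e he e' hlt
      obtain ⟨n, hn⟩ := Set.mem_iUnion.1 he
      exact hmem n ((seq n).2.2.1.1 e hn e' hlt)
    · intro e he e' he'
      obtain ⟨n, hn⟩ := hfinsub {e, e'} (Set.insert_subset he (Set.singleton_subset_iff.2 he'))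
        (Set.toFinite _)
      exact (seq n).2.2.1.2 e (hn (Or.inl rfl)) e' (hn (Or.inr rfl))
  refine ⟨ω, ⟨hω, fun C hC hωC => ?_⟩, hmem 0, fun S hS hSfin => ?_⟩
  · refine (hωC.antisymm fun x hx => ?_).symm
    by_contra hxω
    -- `e` is a minimal event of `C` outside `ω`
    obtain ⟨e, he, heω, hpast⟩ : ∃ e ∈ C, e ∉ ω ∧ U.occ.stump e ⊆ ω := by
      obtain ⟨D, hDfin, hD, hxD, hDC⟩ := hC.exists_finite_superset (Set.finite_singleton x)
        (Set.singleton_subset_iff.2 hx)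
      have hchain := (hω.mono (C := ω ∩ D) Set.inter_subset_left fun y hy z hz =>
        ⟨hω.1 y hy.1 z hz, hD.1 y hy.2 z hz⟩).extend_of_subset hD hDfin Set.inter_subset_right
      rcases Relation.ReflTransGen.cases_head hchain with heq | ⟨A, ⟨e, he, rfl⟩, hA⟩
      · exact (hxω (heq.symm.subset (hxD rfl)).1).elim
      · have heD : e ∈ D := OccNet.subset_of_reflTransGen_extend hA (Or.inr rfl)
        exact ⟨e, hDC heD, fun h => he.1 ⟨h, heD⟩,
          he.stump_subset.trans Set.inter_subset_left⟩
    obtain ⟨n, hn⟩ := hfinsub _ hpast (OccNet.stump_finite e)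
    have henab : ∀ A, (seq n).1 ⊆ A → A ⊆ ω → U.occ.config A → U.occ.enabledBy A e := by
      intro A hnA hAω hA
      refine ⟨fun h => heω (hAω h), hA.union_singleton (hn.trans hnA) ?_⟩
      rintro e' he' ⟨b, hb, hb'⟩
      exact heω (hC.eq_of_pt (hωC (hAω he')) he hb hb' ▸ hAω he')
    have hne : (U.occ.toNet.preT e).Nonempty := by
      rw [Set.nonempty_iff_ne_empty]
      exact fun h => heω (hmem 0 (hiso e h))
    have hen : N.enabled (U.Mark C₁) (U.fE e) := by
      rw [(seq n).2.2.2]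
      exact enabled_of_enabledBy (henab _ subset_rfl (hmem n) (seq n).2.2.1)
    obtain ⟨e₁, he₁, hlab₁⟩ := exists_enabledBy hC₁ (injOn_cut hsafe hfin₁ hC₁) hen (by
      rw [Set.nonempty_iff_ne_empty, ne_eq, ← preT_eq_empty_iff]
      exact hne.ne_empty)
    obtain ⟨s, hsC₂, b₁, hb₁s, hb₁e⟩ := hspoil e₁ he₁
    have hsC₁ : s ∉ C₁ := fun h => (he₁.pre_subset_cut hb₁e).2 ⟨s, h, hb₁s⟩
    obtain ⟨A, s', hAfin, hA, hnA, hs', hAs, hlab⟩ := hreplay (seq n) s hsC₂ hsC₁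
    have hAω : A ∪ {s'} ⊆ ω := hAs.trans (hmem (n + 1))
    have heA := henab A hnA (Set.subset_union_left.trans hAω) hA
    have hp : U.fB b₁ ∈ N.preT (U.fE e) := hlab₁ ▸ (U.pre_bij e₁).mapsTo hb₁e
    have hp' : U.fB b₁ ∈ N.preT (U.fE s') := hlab ▸ (U.pre_bij s).mapsTo hb₁s
    obtain ⟨b, hb, hbp⟩ := (U.pre_bij e).surjOn hp
    obtain ⟨b', hb', hbp'⟩ := (U.pre_bij s').surjOn hp'
    have hbb : b = b' := injOn_cut hsafe hAfin hA (heA.pre_subset_cut hb)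
      (hs'.pre_subset_cut hb') (hbp.trans hbp'.symm)
    have hs'ω : s' ∈ ω := hAω (Or.inr rfl)
    subst hbb
    exact heω (hC.eq_of_pt he (hωC hs'ω) hb hb' ▸ hs'ω)
  · obtain ⟨n, hn⟩ := hfinsub S hS hSfin
    exact ⟨(seq n).1, (seq n).2.1, (seq n).2.2.1, hn, (seq n).2.2.2.symm⟩

theorem exists_loop_of_run [Finite P] [Finite T] {ω : Set E} (hω : U.occ.run ω) {C : Set E}
    (hfin : C.Finite) (hCω : C ⊆ ω) :
    ∃ C₁ C₂ : Set E, C₁.Finite ∧ C₂.Finite ∧ U.occ.config C₁ ∧ U.occ.config C₂ ∧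
      C ⊆ C₁ ∧ C₁ ⊆ C₂ ∧ C₂ ⊆ ω ∧ U.Mark C₁ = U.Mark C₂ ∧
      (∀ e : E, U.occ.enabledBy C₁ e → ∃ e' ∈ C₂, U.occ.spoiler e e') := by
  let X := {D : Set E // D.Finite ∧ U.occ.config D ∧ D ⊆ ω}
  let I : Set E := {e | U.occ.toNet.preT e ⊆ ∅}
  have hIω : I ⊆ ω := by
    intro e he
    have he : U.occ.toNet.preT e = ∅ := Set.subset_empty_iff.1 he
    by_contra hmem
    obtain ⟨e', -, b, -, hb⟩ := hω.exists_spoiler hmem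
      (by rw [OccNet.stump_eq_empty he]; exact Set.empty_subset _)
    exact Set.eq_empty_iff_forall_notMem.1 he b hb
  obtain ⟨D₀, hD₀fin, hD₀, hsub₀, hD₀ω⟩ := hω.1.exists_finite_superset
    (hfin.union (finite_setOf_preT_subset (U := U) Set.finite_empty)) (Set.union_subset hCω hIω)
  have hnext : ∀ D : X, I ⊆ D.1 → ∃ D' : X, D.1 ⊆ D'.1 ∧
      ∀ e : E, U.occ.enabledBy D.1 e → ∃ e' ∈ D'.1, U.occ.spoiler e e' := by
    rintro ⟨D, hDfin, hD, hDω⟩ hI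
    have hex : ∀ e, U.occ.enabledBy D e → ∃ e' ∈ ω, U.occ.spoiler e e' := by
      intro e he
      by_cases hmem : e ∈ ω
      · refine ⟨e, hmem, ?_⟩
        unfold OccNet.spoiler
        rw [Set.inter_self, Set.nonempty_iff_ne_empty]
        exact fun h => he.1 (hI h.subset)
      · exact hω.exists_spoiler hmem (he.stump_subset.trans hDω)
    choose! sp hspω hsp using hex
    obtain ⟨D', hD'fin, hD', hsub, hD'ω⟩ := hω.1.exists_finite_superset
      (hDfin.union ((finite_enabledBy (U := U) hDfin).image sp))
      (Set.union_subset hDω (Set.image_subset_iff.2 hspω))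
    exact ⟨⟨D', hD'fin, hD', hD'ω⟩, Set.subset_union_left.trans hsub, fun e he =>
      ⟨sp e, hsub (Or.inr (Set.mem_image_of_mem sp he)), hsp e he⟩⟩
  choose! next hsubnext hspoil using hnext
  let seq : ℕ → X := fun n => Nat.rec ⟨D₀, hD₀fin, hD₀, hD₀ω⟩ (fun _ D => next D) n
  have hI : ∀ n, I ⊆ (seq n).1 := by
    intro n
    induction n with
    | zero => exact Set.subset_union_right.trans hsub₀
    | succ n ih => exact ih.trans (hsubnext (seq n) ih)
  have hmono : Monotone fun n => (seq n).1 :=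
    monotone_nat_of_le_succ fun n => hsubnext (seq n) (hI n)
  obtain ⟨i, j, hij, heq⟩ : ∃ i j, i < j ∧ U.Mark (seq i).1 = U.Mark (seq j).1 := by
    obtain ⟨i, j, hne, heq⟩ :=
      Finite.exists_ne_map_eq_of_infinite fun n => U.Mark (seq n).1
    rcases lt_or_gt_of_ne hne with h | h
    · exact ⟨i, j, h, heq⟩
    · exact ⟨j, i, h, heq.symm⟩
  refine ⟨(seq i).1, (seq j).1, (seq i).2.1, (seq j).2.1, (seq i).2.2.1, (seq j).2.2.1,
    (Set.subset_union_left.trans hsub₀).trans (hmono (Nat.zero_le i)), hmono hij.le,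
    (seq j).2.2.2, heq, fun e he => ?_⟩
  obtain ⟨e', he', h⟩ := hspoil (seq i) (hI i) e he
  exact ⟨e', hmono (Nat.succ_le_of_lt hij) he', h⟩

end Unfolding

/-- any finite `⊆`-maximal configuration `C'` with `Mark C' ∉ Bad`
witnesses case (b) of Theorem 1 via `C₁ := C₂ := C'` (the spoiler condition
holding vacuously); consequently, a finite configuration `C` is free iff there
exist finite configurations `C ⊆ C₁ ⊆ C₂` with `Mark C₂ ∉ Bad`,
`Mark C₁ = Mark C₂`, and every event enabled by `C₁` has a spoiler in `C₂`. -/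
theorem maximal_instance_and_free_iff_loop
    {P T B E : Type} [Finite P] [Finite T]
    (N : Net P T) (M₀ : Set P) (hsafe : N.safe M₀)
    (U : Unfolding P T N M₀ B E)
    (Bad : Set (Set P)) (hBad : ReachClosed N Bad)
    (C : Set E) (hfin : C.Finite) (hC : U.occ.config C) :
    (∀ C' : Set E, C'.Finite → U.occ.config C' →
        (∀ C'' : Set E, U.occ.config C'' → C' ⊆ C'' → C'' = C') →
        U.Mark C' ∉ Bad →
        (C' ⊆ C' ∧ U.Mark C' ∉ Bad ∧ U.Mark C' = U.Mark C' ∧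
          (∀ e : E, U.occ.enabledBy C' e → ∃ e' ∈ C', U.occ.spoiler e e')))
    ∧ (U.free Bad C ↔
        ∃ C₁ C₂ : Set E, C₁.Finite ∧ C₂.Finite ∧
          U.occ.config C₁ ∧ U.occ.config C₂ ∧
          C ⊆ C₁ ∧ C₁ ⊆ C₂ ∧ U.Mark C₂ ∉ Bad ∧
          U.Mark C₁ = U.Mark C₂ ∧
          (∀ e : E, U.occ.enabledBy C₁ e → ∃ e' ∈ C₂, U.occ.spoiler e e')) := by
  constructor
  · intro C' _ _ hmax hbad
    refine ⟨subset_rfl, hbad, rfl, fun e he => ?_⟩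
    exact (he.1 (hmax _ he.2 Set.subset_union_left ▸ Or.inr rfl)).elim
  · constructor
    · intro hfree
      unfold Unfolding.free Unfolding.doomed at hfree
      push Not at hfree
      obtain ⟨ω, hω, hCω, hgood⟩ := hfree
      obtain ⟨C₁, C₂, h₁, h₂, hC₁, hC₂, hCC₁, hsub, hω₂, hm, hsp⟩ :=
        Unfolding.exists_loop_of_run hω hfin hCω
      exact ⟨C₁, C₂, h₁, h₂, hC₁, hC₂, hCC₁, hsub,
        hgood C₂ h₂ hC₂ (hCC₁.trans hsub) hω₂, hm, hsp⟩
    · rintro ⟨C₁, C₂, -, h₂, hC₁, hC₂, hCC₁, hsub, hbad, hm, hsp⟩ hdoomed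
      obtain ⟨ω, hω, hC₁ω, hcof⟩ :=
        Unfolding.exists_run_of_loop hsafe h₂ hC₁ hC₂ hsub hm hsp
      obtain ⟨C', hC'fin, hC', -, hC'ω, hC'bad⟩ := hdoomed ω hω (hCC₁.trans hC₁ω)
      obtain ⟨D, hDfin, hD, hC'D, hDm⟩ := hcof C' hC'ω hC'fin
      refine hbad ?_
      rw [← hm, ← hDm]
      exact hBad _ hC'bad _ (Unfolding.reach_Mark_of_subset hsafe hC' hD hDfin hC'D)
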